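/- Fix natural numbers i, m and an integer k with 0 ≤ k ≤ m+i and k ≡ −(m+i) (mod 3). Let V_h(k,i,m)_z ⊆ T be the ℂ-span of the holomorphic members of B(k,i,m)_z and let V_h(k,i,m)_u ⊆ S be the ℂ-span of the holomorphic members of B(k,i,m)_u. Then the ℂ-vector space G(k,i,m) := Φ(V_h(k,i,m)_u) ∩ V_h(k,i,m)_z has dimension max(h_z(k,i,m) + h_u(k,i,m) − (m+1), 0), where h_z(k,i,m) = min(m+1, k+1, i+1, m+i−k+1) and h_u(k,i,m) = min(m+1, (k+i+m)/3 + 1, i+1, (2(i+m)−k)/3 + 1). -/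

import Mathlib

noncomputable section

/-- Exponent monoid: `(i₁, i₂, m₁, m₂)` encodes `z1^{i₁} z2^{i₂} w1^{m₁} w2^{m₂}`
(respectively `u1^{i₁} u2^{i₂} v1^{m₁} v2^{m₂}`). -/
abbrev Idx : Type := ℤ × ℤ × ℕ × ℕ

/-- `T = ℂ[z1^{±1}, z2^{±1}][w1, w2]`, as the monoid algebra of `ℤ × ℤ × ℕ × ℕ` over `ℂ`. -/
abbrev T : Type := AddMonoidAlgebra ℂ Idx

/-- `S = ℂ[u1^{±1}, u2^{±1}][v1, v2]`, as the monoid algebra of `ℤ × ℤ × ℕ × ℕ` over `ℂ`. -/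
abbrev S : Type := AddMonoidAlgebra ℂ Idx

/-- The z-monomial `z1^{i₁} z2^{i₂} w1^{m₁} w2^{m₂}` of full type `(i₁, i₂, m₁, m₂)`. -/
def mono (e : Idx) : T := AddMonoidAlgebra.single e 1

/-- The u-monomial `u1^{i₁} u2^{i₂} v1^{m₁} v2^{m₂}` of full type `(i₁, i₂, m₁, m₂)`. -/
def umono (e : Idx) : S := AddMonoidAlgebra.single e 1

/-- `V_h(k,i,m)_z`: the `ℂ`-span in `T` of the holomorphic members of `B(k,i,m)_z`, i.e.
of the z-monomials of full type `(k−m+l, i+m−k−l, m−l, l)`, `0 ≤ l ≤ m`, with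
`k−m+l ≥ 0` and `i+m−k−l ≥ 0`. -/
def Vhz (k i : ℤ) (m : ℕ) : Submodule ℂ T :=
  Submodule.span ℂ
    ((fun l : ℕ => mono (k - (m : ℤ) + (l : ℤ), i + (m : ℤ) - k - (l : ℤ), m - l, l)) ''
      {l : ℕ | l ≤ m ∧ 0 ≤ k - (m : ℤ) + (l : ℤ) ∧ 0 ≤ i + (m : ℤ) - k - (l : ℤ)})

/-- `V_h(k,i,m)_u`: the `ℂ`-span in `S` of the holomorphic members of `B(k,i,m)_u`, i.e.
of the u-monomials of full type `(k'−m+l, i+m−k'−l, m−l, l)`, `0 ≤ l ≤ m`, with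
`k'−m+l ≥ 0` and `i+m−k'−l ≥ 0`, where `k' = (i+m+k)/3`. -/
def Vhu (k' i : ℤ) (m : ℕ) : Submodule ℂ S :=
  Submodule.span ℂ
    ((fun l : ℕ => umono (k' - (m : ℤ) + (l : ℤ), i + (m : ℤ) - k' - (l : ℤ), m - l, l)) ''
      {l : ℕ | l ≤ m ∧ 0 ≤ k' - (m : ℤ) + (l : ℤ) ∧ 0 ≤ i + (m : ℤ) - k' - (l : ℤ)})

/-- `h_z(k,i,m) = min(m+1, k+1, i+1, m+i−k+1)`. -/
def hZ (k i m : ℤ) : ℤ := min (min (m + 1) (k + 1)) (min (i + 1) (m + i - k + 1))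

/-- `h_u(k,i,m) = min(m+1, (k+i+m)/3 + 1, i+1, (2(i+m)−k)/3 + 1)`. -/
def hU (k i m : ℤ) : ℤ :=
  min (min (m + 1) ((k + i + m) / 3 + 1)) (min (i + 1) ((2 * (i + m) - k) / 3 + 1))

open Polynomial Submodule

namespace Polynomial

variable {K : Type*} [Field K]

theorem mul_mem_degreeLT_iff {F : K[X]} (hF : F ≠ 0) (q : K[X]) (n : ℕ) :
    F * q ∈ degreeLT K n ↔ q ∈ degreeLT K (n - F.natDegree) := by
  rcases eq_or_ne q 0 with rfl | hq
  · simp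
  · rw [mem_degreeLT, mem_degreeLT, ← natDegree_lt_iff_degree_lt (mul_ne_zero hF hq),
      ← natDegree_lt_iff_degree_lt hq, natDegree_mul hF hq]
    omega

theorem map_mulLeft_degreeLT_inf {F G : K[X]} (hF : F ≠ 0) (hG : G ≠ 0) (hFG : IsCoprime F G)
    (a b : ℕ) :
    (degreeLT K a).map (LinearMap.mulLeft K F) ⊓ (degreeLT K b).map (LinearMap.mulLeft K G) =
      (degreeLT K (min (a - G.natDegree) (b - F.natDegree))).map
        (LinearMap.mulLeft K (F * G)) := by
  have hmin (q : K[X]) : q ∈ degreeLT K (min (a - G.natDegree) (b - F.natDegree)) ↔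
      G * q ∈ degreeLT K a ∧ F * q ∈ degreeLT K b := by
    rw [mul_mem_degreeLT_iff hF, mul_mem_degreeLT_iff hG, mem_degreeLT, mem_degreeLT,
      mem_degreeLT, ← lt_min_iff]
    norm_cast
  ext p
  simp only [mem_inf, mem_map, LinearMap.mulLeft_apply, hmin]
  constructor
  · rintro ⟨⟨q₁, hq₁, rfl⟩, q₂, hq₂, h⟩
    obtain ⟨q, rfl⟩ : G ∣ q₁ := hFG.symm.dvd_of_dvd_mul_left ⟨q₂, h.symm⟩
    obtain rfl : q₂ = F * q := mul_left_cancel₀ hG (by rw [h]; ring)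
    exact ⟨q, ⟨hq₁, hq₂⟩, by ring⟩
  · rintro ⟨q, ⟨h₁, h₂⟩, rfl⟩
    exact ⟨⟨_, h₁, by ring⟩, _, h₂, by ring⟩

theorem finrank_map_mulLeft_degreeLT {F : K[X]} (hF : F ≠ 0) (n : ℕ) :
    Module.finrank K ((degreeLT K n).map (LinearMap.mulLeft K F)) = n := by
  rw [← (equivMapOfInjective _ (mul_right_injective₀ hF : Function.Injective
    (LinearMap.mulLeft K F)) (degreeLT K n)).finrank_eq, (degreeLTEquiv K n).finrank_eq]
  simp

/-- If `A` and `B` have degree at most one and `B` has a root which is not a root of `A`, then the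
products of `n - 1` factors from `A`, `B` span the polynomials of degree less than `n`. -/
theorem span_pow_mul_pow {A B : K[X]} {r : K} (hA : A.natDegree ≤ 1) (hAr : A.eval r ≠ 0)
    (hB : B.natDegree = 1) (hBr : B.eval r = 0) (n : ℕ) :
    span K {p | ∃ a b, a + b + 1 = n ∧ A ^ a * B ^ b = p} = degreeLT K n := by
  refine le_antisymm (span_le.2 ?_) ?_
  · rintro _ ⟨a, b, rfl, rfl⟩
    have h : (A ^ a * B ^ b).natDegree ≤ a + b :=
      natDegree_mul_le_of_le (by simpa using natDegree_pow_le_of_le a hA)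
        (by simpa using natDegree_pow_le_of_le b hB.le)
    rw [SetLike.mem_coe, mem_degreeLT]
    exact (natDegree_le_iff_degree_le.1 h).trans_lt (by exact_mod_cast (a + b).lt_succ_self)
  induction n with
  | zero =>
    intro p hp
    have : p = 0 := by simpa [mem_degreeLT] using hp
    simp [this]
  | succ n ih =>
    intro p hp
    have hB0 : B ≠ 0 := by rintro rfl; simp at hB
    have hAn : A ^ n ∈ degreeLT K (n + 1) := by
      have h : (A ^ n).natDegree ≤ n := by simpa using natDegree_pow_le_of_le n hA
      rw [mem_degreeLT]
      exact (natDegree_le_iff_degree_le.1 h).trans_lt (by exact_mod_cast n.lt_succ_self)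
    have hBdvd : B ∣ X - C r :=
      ((associated_of_dvd_of_natDegree_le (dvd_iff_isRoot.2 hBr) hB0
        (by rw [hB, natDegree_X_sub_C])).symm).dvd
    obtain ⟨q, hq⟩ : B ∣ p - (p.eval r / A.eval r ^ n) • A ^ n := by
      refine hBdvd.trans (dvd_iff_isRoot.2 ?_)
      simp [div_mul_cancel₀ _ (pow_ne_zero n hAr)]
    have hqn : q ∈ degreeLT K n := by
      have := sub_mem hp (smul_mem _ (p.eval r / A.eval r ^ n) hAn)
      rwa [hq, mul_mem_degreeLT_iff hB0, hB, Nat.add_sub_cancel] at this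
    have hmap : (span K {p | ∃ a b, a + b + 1 = n ∧ A ^ a * B ^ b = p}).map
        (LinearMap.mulLeft K B) ≤ span K {p | ∃ a b, a + b + 1 = n + 1 ∧ A ^ a * B ^ b = p} := by
      rw [map_span, span_le]
      rintro _ ⟨_, ⟨a, b, rfl, rfl⟩, rfl⟩
      exact subset_span ⟨a, b + 1, by ring, by simp only [LinearMap.mulLeft_apply]; ring⟩
    rw [← sub_add_cancel p ((p.eval r / A.eval r ^ n) • A ^ n), hq]
    exact add_mem (hmap ⟨q, ih hqn, rfl⟩)
      (smul_mem _ _ (subset_span ⟨n, 0, by ring, by simp⟩))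

theorem span_image_pow_mul_pow {A B : K[X]} {r : K} (hA : A.natDegree ≤ 1) (hAr : A.eval r ≠ 0)
    (hB : B.natDegree = 1) (hBr : B.eval r = 0) (c d m : ℕ) :
    span K ((fun l : ℕ => A ^ (m - l) * B ^ l) '' {l | d ≤ l ∧ l + c ≤ m}) =
      (degreeLT K (m + 1 - c - d)).map (LinearMap.mulLeft K (A ^ c * B ^ d)) := by
  rw [← span_pow_mul_pow hA hAr hB hBr, map_span]
  congr 1
  ext p
  constructor
  · rintro ⟨l, ⟨h₁, h₂⟩, rfl⟩
    refine ⟨_, ⟨m - l - c, l - d, by omega, rfl⟩, ?_⟩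
    obtain ⟨b, rfl⟩ := Nat.exists_eq_add_of_le h₁
    obtain ⟨a, rfl⟩ := Nat.exists_eq_add_of_le h₂
    simp only [LinearMap.mulLeft_apply]
    rw [show d + b + c + a - (d + b) = c + a by omega, Nat.add_sub_cancel_left,
      Nat.add_sub_cancel_left]
    ring
  · rintro ⟨_, ⟨a, b, h, rfl⟩, rfl⟩
    refine ⟨d + b, ⟨by omega, by omega⟩, ?_⟩
    simp only [LinearMap.mulLeft_apply]
    rw [show m - (d + b) = c + a by omega]
    ring

end Polynomial

theorem mono_mul_mono (e f : Idx) : mono e * mono f = mono (e + f) := by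
  simp [mono, AddMonoidAlgebra.single_mul_single]

theorem mono_pow (e : Idx) (n : ℕ) : mono e ^ n = mono (n • e) := by
  simp [mono, AddMonoidAlgebra.single_pow]

theorem umono_eq_mono (e : Idx) : umono e = mono e := rfl

/-- The linear map sending `X ^ l` to the `l`-th z-monomial of `B(k,i,m)_z`. -/
def formMap (k i : ℤ) (m : ℕ) : ℂ[X] →ₗ[ℂ] T :=
  (basisMonomials ℂ).constr ℂ
    fun l : ℕ => mono (k - (m : ℤ) + (l : ℤ), i + (m : ℤ) - k - (l : ℤ), m - l, l)

theorem formMap_X_pow (k i : ℤ) (m l : ℕ) : formMap k i m (X ^ l) =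
    mono (k - (m : ℤ) + (l : ℤ), i + (m : ℤ) - k - (l : ℤ), m - l, l) := by
  have h := (basisMonomials ℂ).constr_basis ℂ
    (fun l : ℕ => mono (k - (m : ℤ) + (l : ℤ), i + (m : ℤ) - k - (l : ℤ), m - l, l)) l
  simp only [coe_basisMonomials, ← X_pow_eq_monomial] at h
  exact h

theorem formMap_injective (k i : ℤ) (m : ℕ) : Function.Injective (formMap k i m) := by
  have hli : LinearIndependent ℂ fun l : ℕ =>
      mono (k - (m : ℤ) + (l : ℤ), i + (m : ℤ) - k - (l : ℤ), m - l, l) := by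
    have := (AddMonoidAlgebra.basis Idx ℂ).linearIndependent.comp
      (fun l : ℕ => ((k - (m : ℤ) + (l : ℤ), i + (m : ℤ) - k - (l : ℤ), m - l, l) : Idx))
      (fun a b h => by simpa using congrArg (fun e : Idx => e.2.2.2) h)
    convert this using 2 with l
    simp [mono]
  intro p q h
  rw [formMap, Module.Basis.constr_apply, Module.Basis.constr_apply] at h
  exact (basisMonomials ℂ).repr.injective (hli h)

/-- `formMap` is evaluation of the homogenization at `(z1 z2⁻¹ w2, w1)`, up to a monomial. -/
theorem formMap_eq_homogenize (k i : ℤ) (m : ℕ) {p : ℂ[X]} (hp : p.natDegree ≤ m) :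
    formMap k i m p = mono (k - m, i + m - k, 0, 0) *
      MvPolynomial.aeval ![mono (1, -1, 0, 1), mono (0, 0, 1, 0)] (p.homogenize m) := by
  refine Polynomial.induction_with_natDegree_le (fun p ↦ formMap k i m p =
    mono (k - m, i + m - k, 0, 0) *
      MvPolynomial.aeval ![mono (1, -1, 0, 1), mono (0, 0, 1, 0)] (p.homogenize m)) m
    (by simp) ?_ ?_ p hp
  · intro n c _ hn
    rw [homogenize_C_mul, ← smul_eq_C_mul, map_smul, formMap_X_pow, homogenize_X_pow hn,
      ← MvPolynomial.smul_eq_C_mul, map_smul, mul_smul_comm]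
    simp [mono_mul_mono, mono_pow, sub_eq_add_neg]
  · intro p q _ _ hp hq
    simp only [map_add, hp, hq, homogenize_add, mul_add]

theorem homogenize_pow_of_natDegree_le_one {p : ℂ[X]} (hp : p.natDegree ≤ 1) (n : ℕ) :
    (p ^ n).homogenize n = p.homogenize 1 ^ n := by
  induction n with
  | zero => simp
  | succ n ih =>
    rw [pow_succ, pow_succ, homogenize_mul _ _ (by simpa using natDegree_pow_le_of_le n hp) hp, ih]

theorem natDegree_two_sub_X : (C 2 - X : ℂ[X]).natDegree = 1 := by
  compute_degree!

theorem natDegree_two_mul_X_sub_one : (C 2 * X - 1 : ℂ[X]).natDegree = 1 := by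
  compute_degree!

theorem map_umono_of_addMonoidHom (Φ : S →ₐ[ℂ] T) (g g' : ℤ →+ Idx)
    (h : Φ (umono (g 1)) = mono (g' 1)) (n : ℤ) : Φ (umono (g n)) = mono (g' n) := by
  have := MonoidHom.ext_mint
    (f := (Φ : S →* T).comp ((AddMonoidAlgebra.of ℂ Idx).comp (AddMonoidHom.toMultiplicative g)))
    (g := (AddMonoidAlgebra.of ℂ Idx).comp (AddMonoidHom.toMultiplicative g')) h
  exact DFunLike.congr_fun this (Multiplicative.ofAdd n)

theorem map_umono_base {Φ : S →ₐ[ℂ] T}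
    (hΦu1 : Φ (umono (1, 0, 0, 0)) = mono (2, -1, 0, 0))
    (hΦu2 : Φ (umono (0, 1, 0, 0)) = mono (-1, 2, 0, 0))
    (a b : ℤ) :
    Φ (umono (a, b, 0, 0)) = mono (2 * a - b, 2 * b - a, 0, 0) := by
  have h₁ := map_umono_of_addMonoidHom Φ (AddMonoidHom.inl ℤ (ℤ × ℕ × ℕ))
    { toFun := fun n => (2 * n, -n, 0, 0)
      map_zero' := by simp
      map_add' := fun x y => by ext <;> simp <;> ring } hΦu1 a
  have h₂ := map_umono_of_addMonoidHom Φ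
    ((AddMonoidHom.inr ℤ (ℤ × ℕ × ℕ)).comp (AddMonoidHom.inl ℤ (ℕ × ℕ)))
    { toFun := fun n => (-n, 2 * n, 0, 0)
      map_zero' := by simp
      map_add' := fun x y => by ext <;> simp <;> ring } hΦu2 b
  have h : umono (a, b, 0, 0) = umono (a, 0, 0, 0) * umono (0, b, 0, 0) := by
    simp [umono_eq_mono, mono_mul_mono]
  simp only [AddMonoidHom.inl_apply, AddMonoidHom.inr_apply, AddMonoidHom.comp_apply,
    AddMonoidHom.coe_mk, ZeroHom.coe_mk] at h₁ h₂
  rw [h, map_mul]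
  erw [h₁, h₂]
  rw [mono_mul_mono]
  congr 1
  ext <;> simp <;> ring

/-- The pullback of the `l`-th member of `B(k,i,m)_u` is the form
`(2x - y) ^ (m - l) * (2y - x) ^ l` in the variables `x = w1`, `y = z1 z2⁻¹ w2`. -/
theorem map_umono_eq_formMap {Φ : S →ₐ[ℂ] T}
    (hΦu1 : Φ (umono (1, 0, 0, 0)) = mono (2, -1, 0, 0))
    (hΦu2 : Φ (umono (0, 1, 0, 0)) = mono (-1, 2, 0, 0))
    (hΦv1 : Φ (umono (0, 0, 1, 0)) = (2 : ℂ) • mono (1, -1, 1, 0) - mono (2, -2, 0, 1))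
    (hΦv2 : Φ (umono (0, 0, 0, 1)) = -mono (-2, 2, 1, 0) + (2 : ℂ) • mono (-1, 1, 0, 1))
    {i k k' : ℤ} {m l : ℕ} (hl : l ≤ m) (hk' : 3 * k' = i + m + k) :
    Φ (umono (k' - (m : ℤ) + (l : ℤ), i + (m : ℤ) - k' - (l : ℤ), m - l, l)) =
      formMap k i m ((C 2 - X) ^ (m - l) * (C 2 * X - 1) ^ l) := by
  have hA := natDegree_two_sub_X.le
  have hB := natDegree_two_mul_X_sub_one.le
  have hApow : ((C 2 - X : ℂ[X]) ^ (m - l)).natDegree ≤ m - l := by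
    simpa using natDegree_pow_le_of_le (m - l) hA
  have hBpow : ((C 2 * X - 1 : ℂ[X]) ^ l).natDegree ≤ l := by
    simpa using natDegree_pow_le_of_le l hB
  have hdeg := natDegree_mul_le_of_le hApow hBpow
  rw [Nat.sub_add_cancel hl] at hdeg
  have hhom : ((C 2 - X : ℂ[X]) ^ (m - l) * (C 2 * X - 1) ^ l).homogenize m =
      (C 2 - X : ℂ[X]).homogenize 1 ^ (m - l) * (C 2 * X - 1 : ℂ[X]).homogenize 1 ^ l := by
    rw [← homogenize_pow_of_natDegree_le_one hA, ← homogenize_pow_of_natDegree_le_one hB,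
      ← homogenize_mul _ _ hApow hBpow, Nat.sub_add_cancel hl]
  have hv1 : Φ (umono (0, 0, 1, 0)) = mono (1, -1, 0, 0) * MvPolynomial.aeval
      ![mono (1, -1, 0, 1), mono (0, 0, 1, 0)] ((C 2 - X : ℂ[X]).homogenize 1) := by
    rw [hΦv1]
    simp [mul_sub, mono_mul_mono, Algebra.smul_def, mul_left_comm]
  have hv2 : Φ (umono (0, 0, 0, 1)) = mono (-2, 2, 0, 0) * MvPolynomial.aeval
      ![mono (1, -1, 0, 1), mono (0, 0, 1, 0)] ((C 2 * X - 1 : ℂ[X]).homogenize 1) := by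
    rw [hΦv2]
    simp [mul_sub, mono_mul_mono, Algebra.smul_def, mul_left_comm, neg_add_eq_sub]
  have hfact : umono (k' - (m : ℤ) + (l : ℤ), i + (m : ℤ) - k' - (l : ℤ), m - l, l) =
      umono (k' - (m : ℤ) + (l : ℤ), i + (m : ℤ) - k' - (l : ℤ), 0, 0) *
        umono (0, 0, 1, 0) ^ (m - l) * umono (0, 0, 0, 1) ^ l := by
    simp [umono_eq_mono, mono_mul_mono, mono_pow]
  have hmono : mono (k - m, i + m - k, 0, 0) =
      mono (2 * (k' - m + l) - (i + m - k' - l), 2 * (i + m - k' - l) - (k' - m + l), 0, 0) *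
        mono (1, -1, 0, 0) ^ (m - l) * mono (-2, 2, 0, 0) ^ l := by
    simp only [mono_pow, mono_mul_mono]
    congr 1
    ext <;> simp [Nat.cast_sub hl] <;> linarith
  rw [formMap_eq_homogenize _ _ _ hdeg, hhom, hfact]
  simp only [map_mul, map_pow]
  rw [map_umono_base hΦu1 hΦu2, hv1, hv2, hmono]
  ring

theorem map_Vhu {Φ : S →ₐ[ℂ] T}
    (hΦu1 : Φ (umono (1, 0, 0, 0)) = mono (2, -1, 0, 0))
    (hΦu2 : Φ (umono (0, 1, 0, 0)) = mono (-1, 2, 0, 0))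
    (hΦv1 : Φ (umono (0, 0, 1, 0)) = (2 : ℂ) • mono (1, -1, 1, 0) - mono (2, -2, 0, 1))
    (hΦv2 : Φ (umono (0, 0, 0, 1)) = -mono (-2, 2, 1, 0) + (2 : ℂ) • mono (-1, 1, 0, 1))
    {i k k' : ℤ} {m : ℕ} (hk' : 3 * k' = i + m + k) :
    (Vhu k' i m).map Φ.toLinearMap =
      ((degreeLT ℂ (m + 1 - (k' - i).toNat - (m - k').toNat)).map (LinearMap.mulLeft ℂ
        ((C 2 - X) ^ (k' - i).toNat * (C 2 * X - 1) ^ (m - k').toNat))).map (formMap k i m) := by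
  have hset : {l : ℕ | l ≤ m ∧ 0 ≤ k' - (m : ℤ) + (l : ℤ) ∧ 0 ≤ i + (m : ℤ) - k' - (l : ℤ)} =
      {l | (m - k').toNat ≤ l ∧ l + (k' - i).toNat ≤ m} := by
    ext l
    simp only [Set.mem_ofPred_eq]
    omega
  rw [← span_image_pow_mul_pow (r := 1 / 2) natDegree_two_sub_X.le (by norm_num)
    natDegree_two_mul_X_sub_one (by simp), Vhu, hset, map_span, map_span, Set.image_image,
    Set.image_image]
  congr 1
  refine Set.image_congr fun l hl => ?_
  exact map_umono_eq_formMap hΦu1 hΦu2 hΦv1 hΦv2 (by have := hl.2; omega) hk'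

theorem Vhz_eq_map (k i : ℤ) (m : ℕ) :
    Vhz k i m = ((degreeLT ℂ (m + 1 - (k - i).toNat - (m - k).toNat)).map
      (LinearMap.mulLeft ℂ (X ^ (m - k).toNat))).map (formMap k i m) := by
  have hset : {l : ℕ | l ≤ m ∧ 0 ≤ k - (m : ℤ) + (l : ℤ) ∧ 0 ≤ i + (m : ℤ) - k - (l : ℤ)} =
      {l | (m - k).toNat ≤ l ∧ l + (k - i).toNat ≤ m} := by
    ext l
    simp only [Set.mem_ofPred_eq]
    omega
  have h := span_image_pow_mul_pow (A := (1 : ℂ[X])) (B := X) (r := 0) (by simp) (by simp)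
    (by simp) (by simp) (k - i).toNat (m - k).toNat m
  simp only [one_pow, one_mul] at h
  rw [← h, Vhz, hset, map_span, Set.image_image]
  simp only [formMap_X_pow]

theorem hZ_eq (i m : ℕ) (k : ℤ) :
    hZ k i m = m + 1 - (k - i).toNat - (m - k).toNat := by
  unfold hZ
  omega

theorem hU_eq {i m : ℕ} {k k' : ℤ} (hk' : 3 * k' = (i : ℤ) + (m : ℤ) + k) :
    hU k i m = m + 1 - (k' - i).toNat - (m - k').toNat := by
  have h₁ : (k + i + m) / 3 = k' := by omega
  have h₂ : (2 * ((i : ℤ) + m) - k) / 3 = m + i - k' := by omega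
  rw [← hZ_eq, hU, hZ, h₁, h₂]

theorem isCoprime_X_pow_mul (a c d : ℕ) :
    IsCoprime (X ^ a : ℂ[X]) ((C 2 - X) ^ c * (C 2 * X - 1) ^ d) := by
  refine IsCoprime.mul_right (IsCoprime.pow ?_) (IsCoprime.pow ?_)
  · refine ⟨C (1 / 2), C (1 / 2), ?_⟩
    rw [mul_sub, ← C_mul]
    norm_num
  · exact ⟨C 2, -1, by ring⟩

/-- Let `Φ : S → T` be the pullback `ℂ`-algebra homomorphism (`Φ(u1) = z1²·z2⁻¹`,
`Φ(u2) = z2²·z1⁻¹`, `Φ(v1) = 2·z1·z2⁻¹·w1 − z1²·z2⁻²·w2`,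
`Φ(v2) = −z2²·z1⁻²·w1 + 2·z2·z1⁻¹·w2`).  Fix naturals `i, m` and an integer `k` with
`0 ≤ k ≤ m+i` and `k ≡ −(m+i) (mod 3)`, and set `k' = (i+m+k)/3`.  Then the space
`G(k,i,m) = Φ(V_h(k,i,m)_u) ∩ V_h(k,i,m)_z` has dimension
`max(h_z(k,i,m) + h_u(k,i,m) − (m+1), 0)`. -/
theorem dim_G_kim (Φ : S →ₐ[ℂ] T)
    (hΦu1 : Φ (umono (1, 0, 0, 0)) = mono (2, -1, 0, 0))
    (hΦu2 : Φ (umono (0, 1, 0, 0)) = mono (-1, 2, 0, 0))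
    (hΦv1 : Φ (umono (0, 0, 1, 0)) = (2 : ℂ) • mono (1, -1, 1, 0) - mono (2, -2, 0, 1))
    (hΦv2 : Φ (umono (0, 0, 0, 1)) = -mono (-2, 2, 1, 0) + (2 : ℂ) • mono (-1, 1, 0, 1))
    (i m : ℕ) (k k' : ℤ) (hk0 : 0 ≤ k) (hk1 : k ≤ (m : ℤ) + (i : ℤ))
    (hk : k ≡ -((m : ℤ) + (i : ℤ)) [ZMOD 3]) (hk' : 3 * k' = (i : ℤ) + (m : ℤ) + k) :
    (Module.finrank ℂ
        ↥((Vhu k' (i : ℤ) m).map Φ.toLinearMap ⊓ Vhz k (i : ℤ) m) : ℤ)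
      = max (hZ k (i : ℤ) (m : ℤ) + hU k (i : ℤ) (m : ℤ) - ((m : ℤ) + 1)) 0 := by
  obtain ⟨hA, hB⟩ : (C 2 - X : ℂ[X]) ≠ 0 ∧ (C 2 * X - 1 : ℂ[X]) ≠ 0 :=
    ⟨ne_zero_of_natDegree_gt (n := 0) (by rw [natDegree_two_sub_X]; exact one_pos),
      ne_zero_of_natDegree_gt (n := 0) (by rw [natDegree_two_mul_X_sub_one]; exact one_pos)⟩
  have hG : ((C 2 - X) ^ (k' - i).toNat * (C 2 * X - 1) ^ (m - k').toNat : ℂ[X]) ≠ 0 :=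
    mul_ne_zero (pow_ne_zero _ hA) (pow_ne_zero _ hB)
  have hF : (X ^ (m - k).toNat : ℂ[X]) ≠ 0 := pow_ne_zero _ X_ne_zero
  rw [map_Vhu hΦu1 hΦu2 hΦv1 hΦv2 hk', Vhz_eq_map, ← map_inf _ (formMap_injective k i m),
    ← (equivMapOfInjective _ (formMap_injective k i m) _).finrank_eq, inf_comm,
    map_mulLeft_degreeLT_inf hF hG (isCoprime_X_pow_mul _ _ _),
    finrank_map_mulLeft_degreeLT (mul_ne_zero hF hG), natDegree_X_pow,
    natDegree_mul (pow_ne_zero _ hA) (pow_ne_zero _ hB), natDegree_pow, natDegree_pow,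
    natDegree_two_sub_X, natDegree_two_mul_X_sub_one, hZ_eq, hU_eq hk']
  omega
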